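/- arXiv:2504.02208 — 6 statements merged into one kernel-verified Lean document; each statement's English description precedes it below -/
import Mathlib

section
/- Let ρ be a positive semidefinite complex n×n matrix with trace 1, and let 𝓛 be a linear map on n×n complex matrices such that ‖exp(s𝓛)[X]‖ ≤ ‖X‖ for all s ≥ 0 and all matrices X (operator-norm contraction semigroup). For t > 0 define the time-averaged map R_t[O] := (1/t) ∫₀ᵗ exp(s𝓛)[O] ds. Then for every matrix O with ‖O‖ ≤ 1, the Dirichlet-form quantity satisfies |⟨R_t[O], 𝓛[R_t[O]]⟩_ρ| ≤ 2/t, where ⟨X,Y⟩_ρ := Tr[X† ρ^{1/2} Y ρ^{1/2}] is the KMS inner product. -/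
open MeasureTheory
open scoped Matrix.Norms.L2Operator ComplexOrder Matrix MatrixOrder

/-- The exponential `exp(𝓛)` of a superoperator `𝓛` on matrices, applied to a matrix `X`;
it is given by the convergent power series `Σ_k 𝓛^k[X]/k!`. -/
noncomputable def expSuper {n : ℕ}
    (L : Matrix (Fin n) (Fin n) ℂ →ₗ[ℂ] Matrix (Fin n) (Fin n) ℂ)
    (X : Matrix (Fin n) (Fin n) ℂ) : Matrix (Fin n) (Fin n) ℂ :=
  ∑' k : ℕ, (k.factorial : ℂ)⁻¹ • (L ^ k) X

/-- The KMS inner product `⟨X,Y⟩_ρ := Tr[X† ρ^{1/2} Y ρ^{1/2}]` associated with a positive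
semidefinite matrix `ρ`, where `ρ^{1/2}` is its positive semidefinite square root. -/
noncomputable def kmsInner {n : ℕ} {ρ : Matrix (Fin n) (Fin n) ℂ} (hρ : ρ.PosSemidef)
    (X Y : Matrix (Fin n) (Fin n) ℂ) : ℂ :=
  (Xᴴ * CFC.sqrt ρ * Y * CFC.sqrt ρ).trace

/-- Left multiplication by `A` increases the squared Hilbert–Schmidt norm at most by the
factor `‖A‖ ^ 2`. -/
theorem sum_sq_norm_mul_le {n : ℕ} (A B : Matrix (Fin n) (Fin n) ℂ) :
    ∑ j, ∑ i, ‖(A * B) i j‖ ^ 2 ≤ ‖A‖ ^ 2 * ∑ j, ∑ i, ‖B i j‖ ^ 2 := by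
  rw [Finset.mul_sum]
  refine Finset.sum_le_sum fun j _ => ?_
  have h := Matrix.l2_opNorm_mulVec A (WithLp.toLp 2 (B.col j))
  have h2 := pow_le_pow_left₀ (norm_nonneg _) h 2
  rw [mul_pow, EuclideanSpace.norm_sq_eq, EuclideanSpace.norm_sq_eq] at h2
  simpa [Matrix.mul_apply, Matrix.mulVec, dotProduct] using h2

/-- The Cauchy–Schwarz inequality for the trace pairing. -/
theorem norm_trace_mul_le {n : ℕ} (A B : Matrix (Fin n) (Fin n) ℂ) :
    ‖(A * B).trace‖ ≤
      √(∑ j, ∑ i, ‖A i j‖ ^ 2) * √(∑ j, ∑ i, ‖B i j‖ ^ 2) := by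
  have h := Real.sum_mul_le_sqrt_mul_sqrt Finset.univ
    (fun p : Fin n × Fin n => ‖A p.2 p.1‖) (fun p => ‖B p.1 p.2‖)
  simp only [Fintype.sum_prod_type] at h
  rw [Finset.sum_comm (f := fun j i => ‖B i j‖ ^ 2)]
  refine le_trans ?_ h
  rw [Finset.sum_comm]
  simp only [Matrix.trace, Matrix.diag, Matrix.mul_apply]
  refine (norm_sum_le _ _).trans (Finset.sum_le_sum fun i _ => ?_)
  refine (norm_sum_le _ _).trans (Finset.sum_le_sum fun j _ => ?_)
  rw [norm_mul]

/-- The squared Hilbert–Schmidt norm of `ρ^{1/2}` is the trace of `ρ`. -/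
theorem sum_sq_norm_sqrt {n : ℕ} {ρ : Matrix (Fin n) (Fin n) ℂ} (hρ : ρ.PosSemidef) :
    ((∑ j, ∑ i, ‖CFC.sqrt ρ i j‖ ^ 2 : ℝ) : ℂ) = ρ.trace := by
  have hs : (CFC.sqrt ρ)ᴴ = CFC.sqrt ρ :=
    (Matrix.nonneg_iff_posSemidef.mp (CFC.sqrt_nonneg ρ)).isHermitian
  have h : (CFC.sqrt ρ)ᴴ * CFC.sqrt ρ = ρ := by
    rw [hs]
    exact CFC.sqrt_mul_sqrt_self ρ (Matrix.nonneg_iff_posSemidef.mpr hρ)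
  conv_rhs => rw [← h]
  simp only [Matrix.trace, Matrix.diag, Matrix.mul_apply, Matrix.conjTranspose_apply]
  push_cast
  refine Finset.sum_congr rfl fun j _ => Finset.sum_congr rfl fun i _ => ?_
  exact (RCLike.conj_mul _).symm

/-- For a density matrix `ρ` the KMS inner product is bounded by the operator norms. -/
theorem norm_kmsInner_le {n : ℕ} {ρ : Matrix (Fin n) (Fin n) ℂ} (hρ : ρ.PosSemidef)
    (hTr : ρ.trace = 1) (X Y : Matrix (Fin n) (Fin n) ℂ) :
    ‖kmsInner hρ X Y‖ ≤ ‖X‖ * ‖Y‖ := by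
  have hσ : ∑ j, ∑ i, ‖CFC.sqrt ρ i j‖ ^ 2 = (1 : ℝ) := by
    exact_mod_cast (sum_sq_norm_sqrt hρ).trans hTr
  have hmul (A : Matrix (Fin n) (Fin n) ℂ) :
      √(∑ j, ∑ i, ‖(A * CFC.sqrt ρ) i j‖ ^ 2) ≤ ‖A‖ := by
    refine Real.sqrt_le_iff.mpr ⟨norm_nonneg _, ?_⟩
    simpa [hσ] using sum_sq_norm_mul_le A (CFC.sqrt ρ)
  have h := norm_trace_mul_le (Xᴴ * CFC.sqrt ρ) (Y * CFC.sqrt ρ)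
  rw [kmsInner, Matrix.mul_assoc]
  refine h.trans ?_
  have hX := hmul Xᴴ
  rw [Matrix.l2_opNorm_conjTranspose] at hX
  exact mul_le_mul hX (hmul Y) (Real.sqrt_nonneg _) (norm_nonneg _)

/-- `expSuper` is the exponential in the Banach algebra of continuous superoperators. -/
theorem expSuper_smul_eq_exp {n : ℕ}
    (L : Matrix (Fin n) (Fin n) ℂ →ₗ[ℂ] Matrix (Fin n) (Fin n) ℂ) (s : ℝ)
    (X : Matrix (Fin n) (Fin n) ℂ) :
    expSuper (s • L) X = NormedSpace.exp (s • LinearMap.toContinuousLinearMap L) X := by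
  have hsum := NormedSpace.exp_series_hasSum_exp' (𝕂 := ℂ)
    (s • LinearMap.toContinuousLinearMap L)
  have hX := (ContinuousLinearMap.apply ℂ (Matrix (Fin n) (Fin n) ℂ) X).hasSum hsum
  rw [expSuper]
  refine Eq.trans (tsum_congr fun k => ?_) hX.tsum_eq
  have hpow : (((s • LinearMap.toContinuousLinearMap L) ^ k :
      Matrix (Fin n) (Fin n) ℂ →L[ℂ] Matrix (Fin n) (Fin n) ℂ) : _ →ₗ[ℂ] _) = (s • L) ^ k := by
    rw [ContinuousLinearMap.toLinearMap_pow]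
    rfl
  rw [← hpow]
  rfl

/-- The orbit `s ↦ exp(s𝓛)[X]` solves `d/ds exp(s𝓛)[X] = 𝓛[exp(s𝓛)[X]]`. -/
theorem hasDerivAt_expSuper_smul {n : ℕ}
    (L : Matrix (Fin n) (Fin n) ℂ →ₗ[ℂ] Matrix (Fin n) (Fin n) ℂ)
    (X : Matrix (Fin n) (Fin n) ℂ) (s : ℝ) :
    HasDerivAt (fun s : ℝ => expSuper (s • L) X) (L (expSuper (s • L) X)) s := by
  simp only [expSuper_smul_eq_exp]
  have h := hasDerivAt_exp_smul_const' (𝕂 := ℝ) (LinearMap.toContinuousLinearMap L) s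
  exact ((ContinuousLinearMap.apply ℂ (Matrix (Fin n) (Fin n) ℂ) X).restrictScalars
    ℝ).hasFDerivAt.comp_hasDerivAt s h

/-- `𝓛[∫₀ᵗ exp(s𝓛)[X] ds] = exp(t𝓛)[X] - X`. -/
theorem map_integral_expSuper_smul {n : ℕ}
    (L : Matrix (Fin n) (Fin n) ℂ →ₗ[ℂ] Matrix (Fin n) (Fin n) ℂ)
    (X : Matrix (Fin n) (Fin n) ℂ) (t : ℝ) :
    L (∫ s in (0:ℝ)..t, expSuper (s • L) X) = expSuper (t • L) X - X := by
  have hcont : Continuous fun s : ℝ => expSuper (s • L) X :=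
    continuous_iff_continuousAt.mpr fun s => (hasDerivAt_expSuper_smul L X s).continuousAt
  have hcomm := (LinearMap.toContinuousLinearMap L).intervalIntegral_comp_comm
    (hcont.intervalIntegrable (μ := volume) 0 t)
  have hLcont : Continuous fun s : ℝ => L (expSuper (s • L) X) :=
    (LinearMap.toContinuousLinearMap L).continuous.comp hcont
  have hftc := intervalIntegral.integral_eq_sub_of_hasDerivAt
    (fun s _ => hasDerivAt_expSuper_smul L X s) (hLcont.intervalIntegrable (μ := volume) 0 t)
  have hzero : expSuper ((0 : ℝ) • L) X = X := by
    have h : (0 : ℝ) • LinearMap.toContinuousLinearMap L = 0 := by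
      ext1 Y
      exact zero_smul ℝ (L Y)
    rw [expSuper_smul_eq_exp, h, NormedSpace.exp_zero, one_apply_eq_self]
  rw [hzero] at hftc
  exact hcomm.symm.trans hftc

/-- Approximate stationarity of the Dirichlet form under time-averaging: if `exp(s𝓛)` is an
operator-norm contraction semigroup on matrices, then for any `‖O‖ ≤ 1` the time-averaged
matrix `R_t[O] = (1/t)∫₀ᵗ exp(s𝓛)[O] ds` satisfies `|⟨R_t[O], 𝓛[R_t[O]]⟩_ρ| ≤ 2/t`,
where `⟨·,·⟩_ρ` is the KMS inner product and `‖·‖` the spectral norm. -/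
theorem kms_dirichlet_timeAverage_le {n : ℕ}
    (ρ : Matrix (Fin n) (Fin n) ℂ) (hρ : ρ.PosSemidef) (hTr : ρ.trace = 1)
    (L : Matrix (Fin n) (Fin n) ℂ →ₗ[ℂ] Matrix (Fin n) (Fin n) ℂ)
    (hL : ∀ s : ℝ, 0 ≤ s → ∀ X : Matrix (Fin n) (Fin n) ℂ,
      ‖expSuper (s • L) X‖ ≤ ‖X‖)
    (t : ℝ) (ht : 0 < t) (O : Matrix (Fin n) (Fin n) ℂ) (hO : ‖O‖ ≤ 1) :
    ‖kmsInner hρ ((1 / t) • ∫ s in (0:ℝ)..t, expSuper (s • L) O)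
        (L ((1 / t) • ∫ s in (0:ℝ)..t, expSuper (s • L) O))‖ ≤ 2 / t := by
  set I := ∫ s in (0:ℝ)..t, expSuper (s • L) O with hI
  have hIle : ‖I‖ ≤ t := by
    have h := intervalIntegral.norm_integral_le_of_norm_le_const (a := 0) (b := t) (C := 1)
      (f := fun s : ℝ => expSuper (s • L) O) fun s hs =>
        (hL s (Set.uIoc_of_le ht.le ▸ hs).1.le O).trans hO
    simpa [abs_of_pos ht] using h
  have hLI : ‖L I‖ ≤ 2 := by
    rw [hI, map_integral_expSuper_smul]
    linarith [norm_sub_le (expSuper (t • L) O) O, hL t ht.le O]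
  have hsmul : L ((1 / t) • I) = (1 / t) • L I := L.map_smul_of_tower _ _
  refine (norm_kmsInner_le hρ hTr _ _).trans ?_
  rw [hsmul, norm_smul, norm_smul, Real.norm_of_nonneg (by positivity)]
  calc 1 / t * ‖I‖ * (1 / t * ‖L I‖) ≤ 1 / t * t * (1 / t * 2) := by gcongr
    _ = 2 / t := by field_simp
end

section
/- Let H be a Hermitian n×n complex matrix, A an n×n complex matrix, σ > 0, and let Â(ω) := Σ_{ν∈B(H)} A_ν f̂(ω−ν) be the operator Fourier transform of A, where A_ν := Σ_{E₂−E₁=ν} P_{E₂} A P_{E₁} (P_E the eigenprojections of H, B(H) the set of eigenvalue differences) and f̂(ω) = (σ√(2π))^{−1/2} exp(−ω²/(4σ²)). Then for all real β and ω: exp(βH) Â(ω) exp(−βH) = e^{βω} · e^{σ²β²} · Â(ω + 2σ²β). Consequently, if ‖A‖ ≤ 1 then ‖exp(βH) Â(ω) exp(−βH)‖ ≤ (e^{σ²β²}/√(σ√(2π))) · e^{βω}, where ‖·‖ is the operator (spectral) norm. -/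
open MeasureTheory Matrix
open scoped Classical

noncomputable section

variable {n : ℕ}

/-- The orthogonal projection `P_E` onto the `E`-eigenspace of a Hermitian matrix `H`. -/
def eigenspaceProj {H : Matrix (Fin n) (Fin n) ℂ} (hH : H.IsHermitian) (E : ℝ) :
    Matrix (Fin n) (Fin n) ℂ :=
  ∑ i ∈ Finset.univ.filter (fun i => hH.eigenvalues i = E),
    (hH.eigenvectorUnitary : Matrix (Fin n) (Fin n) ℂ) * Matrix.single i i 1 *
      (star (hH.eigenvectorUnitary : Matrix (Fin n) (Fin n) ℂ))

/-- The finite set of eigenvalues of a Hermitian matrix `H`. -/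
def eigenvalueSet {H : Matrix (Fin n) (Fin n) ℂ} (hH : H.IsHermitian) : Finset ℝ :=
  Finset.univ.image hH.eigenvalues

/-- The finite set `B(H)` of Bohr frequencies (differences of eigenvalues) of `H`. -/
def bohrSet {H : Matrix (Fin n) (Fin n) ℂ} (hH : H.IsHermitian) : Finset ℝ :=
  (eigenvalueSet hH ×ˢ eigenvalueSet hH).image (fun p => p.2 - p.1)

/-- `A_ν := Σ_{(E₁,E₂): E₂−E₁=ν} P_{E₂} A P_{E₁}`, the component of `A` changing the energy
of `H` by exactly `ν`. -/
def bohrComponent {H : Matrix (Fin n) (Fin n) ℂ} (hH : H.IsHermitian)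
    (A : Matrix (Fin n) (Fin n) ℂ) (ν : ℝ) : Matrix (Fin n) (Fin n) ℂ :=
  ∑ p ∈ (eigenvalueSet hH ×ˢ eigenvalueSet hH).filter (fun p => p.2 - p.1 = ν),
    eigenspaceProj hH p.2 * A * eigenspaceProj hH p.1

/-- The Gaussian weight `f̂(ω) = (σ√(2π))^{−1/2} exp(−ω²/(4σ²))`. -/
def gaussianWeight (σ ω : ℝ) : ℝ :=
  (Real.sqrt (σ * Real.sqrt (2 * Real.pi)))⁻¹ * Real.exp (-ω ^ 2 / (4 * σ ^ 2))

/-- The operator Fourier transform `Â(ω) := Σ_{ν ∈ B(H)} A_ν f̂(ω−ν)`. -/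
def oft {H : Matrix (Fin n) (Fin n) ℂ} (hH : H.IsHermitian)
    (A : Matrix (Fin n) (Fin n) ℂ) (σ ω : ℝ) : Matrix (Fin n) (Fin n) ℂ :=
  ∑ ν ∈ bohrSet hH, (gaussianWeight σ (ω - ν) : ℂ) • bohrComponent hH A ν

end

open scoped Matrix.Norms.L2Operator

lemma Matrix.diagonal_mul_single_one {m R : Type*} [Fintype m] [DecidableEq m] [Semiring R]
    (d : m → R) (i : m) :
    Matrix.diagonal d * Matrix.single i i 1 = d i • Matrix.single i i 1 := by
  ext j k
  by_cases hj : i = j <;> simp [Matrix.diagonal_mul, Matrix.single_apply, hj]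

lemma Matrix.single_one_mul_diagonal {m R : Type*} [Fintype m] [DecidableEq m] [CommSemiring R]
    (d : m → R) (i : m) :
    Matrix.single i i 1 * Matrix.diagonal d = d i • Matrix.single i i 1 := by
  ext j k
  by_cases hk : i = k <;> simp [Matrix.mul_diagonal, Matrix.single_apply, hk]

section BohrDecomposition

variable {n : ℕ} {H : Matrix (Fin n) (Fin n) ℂ} (hH : H.IsHermitian)

/-- `exp (z H)` is diagonal in the eigenbasis of `H`, with entries `exp (z Eᵢ)`. -/
lemma exp_smul_eq_eigenvectorUnitary_conj (z : ℂ) :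
    NormedSpace.exp (z • H) =
      (hH.eigenvectorUnitary : Matrix (Fin n) (Fin n) ℂ) *
        Matrix.diagonal (fun i => Complex.exp (z * hH.eigenvalues i)) *
        star (hH.eigenvectorUnitary : Matrix (Fin n) (Fin n) ℂ) := by
  set U := (hH.eigenvectorUnitary : Matrix (Fin n) (Fin n) ℂ) with hU
  have hinv : U⁻¹ = star U :=
    Matrix.inv_eq_left_inv (Unitary.coe_star_mul_self hH.eigenvectorUnitary)
  have hunit : IsUnit U := (Unitary.toUnits hH.eigenvectorUnitary).isUnit
  have hH' : z • H = U * Matrix.diagonal (fun i => z * (hH.eigenvalues i : ℂ)) * U⁻¹ := by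
    conv_lhs => rw [hH.spectral_theorem]
    rw [Unitary.conjStarAlgAut_apply, hinv, ← hU, ← Matrix.smul_mul, ← Matrix.mul_smul,
      ← Matrix.diagonal_smul]
    rfl
  rw [hH', Matrix.exp_conj _ _ hunit, Matrix.exp_diagonal, hinv]
  congr 3
  funext i
  rw [Pi.coe_exp, Complex.exp_eq_exp_ℂ]

lemma exp_smul_mul_eigenspaceProj (z : ℂ) (E : ℝ) :
    NormedSpace.exp (z • H) * eigenspaceProj hH E =
      Complex.exp (z * E) • eigenspaceProj hH E := by
  rw [exp_smul_eq_eigenvectorUnitary_conj hH, eigenspaceProj, Finset.mul_sum, Finset.smul_sum]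
  refine Finset.sum_congr rfl fun i hi => ?_
  rw [← (Finset.mem_filter.mp hi).2]
  set U := (hH.eigenvectorUnitary : Matrix (Fin n) (Fin n) ℂ)
  have hU : star U * U = 1 := Unitary.coe_star_mul_self hH.eigenvectorUnitary
  calc _ = U * Matrix.diagonal (fun i => Complex.exp (z * hH.eigenvalues i)) * (star U * U) *
          Matrix.single i i 1 * star U := by simp only [mul_assoc]
    _ = _ := by
      rw [hU, mul_one, mul_assoc U, Matrix.diagonal_mul_single_one,
        mul_smul_comm, smul_mul_assoc]

lemma eigenspaceProj_mul_exp_smul (z : ℂ) (E : ℝ) :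
    eigenspaceProj hH E * NormedSpace.exp (z • H) =
      Complex.exp (z * E) • eigenspaceProj hH E := by
  rw [exp_smul_eq_eigenvectorUnitary_conj hH, eigenspaceProj, Finset.sum_mul, Finset.smul_sum]
  refine Finset.sum_congr rfl fun i hi => ?_
  rw [← (Finset.mem_filter.mp hi).2]
  set U := (hH.eigenvectorUnitary : Matrix (Fin n) (Fin n) ℂ)
  have hU : star U * U = 1 := Unitary.coe_star_mul_self hH.eigenvectorUnitary
  calc _ = U * Matrix.single i i 1 * (star U * U) *
          Matrix.diagonal (fun i => Complex.exp (z * hH.eigenvalues i)) * star U := by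
        simp only [mul_assoc]
    _ = _ := by
      rw [hU, mul_one, mul_assoc U, Matrix.single_one_mul_diagonal,
        mul_smul_comm, smul_mul_assoc]

lemma sum_eigenspaceProj : ∑ E ∈ eigenvalueSet hH, eigenspaceProj hH E = 1 := by
  simp only [eigenspaceProj, eigenvalueSet]
  rw [Finset.sum_fiberwise_of_maps_to (fun i _ => Finset.mem_image_of_mem _ (Finset.mem_univ i)),
    ← Finset.sum_mul, ← Finset.mul_sum, Matrix.sum_single_one, mul_one]
  exact Unitary.coe_mul_star_self hH.eigenvectorUnitary

lemma sum_bohrComponent (A : Matrix (Fin n) (Fin n) ℂ) :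
    ∑ ν ∈ bohrSet hH, bohrComponent hH A ν = A := by
  simp only [bohrComponent, bohrSet]
  rw [Finset.sum_fiberwise_of_maps_to (fun p hp => Finset.mem_image_of_mem _ hp),
    Finset.sum_product_right]
  simp only [← Finset.mul_sum, ← Finset.sum_mul, sum_eigenspaceProj, mul_one, one_mul]

lemma exp_conj_bohrComponent (A : Matrix (Fin n) (Fin n) ℂ) (z : ℂ) (ν : ℝ) :
    NormedSpace.exp (z • H) * bohrComponent hH A ν * NormedSpace.exp (-z • H) =
      Complex.exp (z * ν) • bohrComponent hH A ν := by
  rw [bohrComponent, Finset.mul_sum, Finset.sum_mul, Finset.smul_sum]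
  refine Finset.sum_congr rfl fun p hp => ?_
  rw [← (Finset.mem_filter.mp hp).2]
  calc _ = (NormedSpace.exp (z • H) * eigenspaceProj hH p.2) * A *
          (eigenspaceProj hH p.1 * NormedSpace.exp (-z • H)) := by simp only [mul_assoc]
    _ = _ := by
      rw [exp_smul_mul_eigenspaceProj, eigenspaceProj_mul_exp_smul, smul_mul_assoc,
        smul_mul_assoc, mul_smul_comm, smul_smul, ← Complex.exp_add]
      congr 2
      push_cast
      ring

lemma exp_conj_eq_sum_bohrComponent (A : Matrix (Fin n) (Fin n) ℂ) (z : ℂ) :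
    NormedSpace.exp (z • H) * A * NormedSpace.exp (-z • H) =
      ∑ ν ∈ bohrSet hH, Complex.exp (z * ν) • bohrComponent hH A ν := by
  conv_lhs => rw [← sum_bohrComponent hH A]
  rw [Finset.mul_sum, Finset.sum_mul]
  exact Finset.sum_congr rfl fun ν _ => exp_conj_bohrComponent hH A z ν

end BohrDecomposition

lemma exp_I_smul_mem_unitary {n : ℕ} {H : Matrix (Fin n) (Fin n) ℂ} (hH : H.IsHermitian)
    (t : ℝ) :
    NormedSpace.exp (((t : ℂ) * Complex.I) • H) ∈ unitary (Matrix (Fin n) (Fin n) ℂ) := by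
  let _ : NormedAlgebra ℚ (Matrix (Fin n) (Fin n) ℂ) := .restrictScalars ℚ ℂ _
  refine NormedSpace.exp_mem_unitary_of_mem_skewAdjoint ?_
  rw [skewAdjoint.mem_iff, star_smul, Matrix.star_eq_conjTranspose, hH.eq]
  simp

/-- Completing the square in the Gaussian weight. -/
lemma exp_mul_gaussianWeight (σ : ℝ) (hσ : 0 < σ) (β ω ν : ℝ) :
    Real.exp (β * ν) * gaussianWeight σ (ω - ν) =
      Real.exp (β * ω) * Real.exp (σ ^ 2 * β ^ 2) *
        gaussianWeight σ (ω + 2 * σ ^ 2 * β - ν) := by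
  simp only [gaussianWeight]
  rw [mul_left_comm, mul_left_comm (_ * _), ← Real.exp_add, ← Real.exp_add, ← Real.exp_add]
  congr 2
  field_simp
  ring

/-- The Gaussian weight is a multiple of the characteristic function of a centred Gaussian. -/
lemma gaussianWeight_eq_integral (σ ω : ℝ) :
    (gaussianWeight σ ω : ℂ) = ((Real.sqrt (σ * Real.sqrt (2 * Real.pi)))⁻¹ : ℝ) *
      ∫ x, Complex.exp (ω * x * Complex.I)
        ∂(ProbabilityTheory.gaussianReal 0 (Real.toNNReal (1 / (2 * σ ^ 2)))) := by
  rw [← charFun_apply_real, ProbabilityTheory.charFun_gaussianReal,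
    Real.coe_toNNReal _ (by positivity), gaussianWeight]
  push_cast
  congr 2
  ring

lemma norm_oft_le {n : ℕ} {H : Matrix (Fin n) (Fin n) ℂ} (hH : H.IsHermitian)
    (A : Matrix (Fin n) (Fin n) ℂ) (σ ω : ℝ) :
    ‖oft hH A σ ω‖ ≤ (Real.sqrt (σ * Real.sqrt (2 * Real.pi)))⁻¹ * ‖A‖ := by
  set c : ℝ := (Real.sqrt (σ * Real.sqrt (2 * Real.pi)))⁻¹ with hc
  set γ := ProbabilityTheory.gaussianReal 0 (Real.toNNReal (1 / (2 * σ ^ 2))) with hγ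
  have hconj (x : ℝ) :
      Complex.exp (ω * x * Complex.I) • (NormedSpace.exp ((((-x : ℝ) : ℂ) * Complex.I) • H) * A *
          NormedSpace.exp (-(((-x : ℝ) : ℂ) * Complex.I) • H)) =
        ∑ ν ∈ bohrSet hH,
          Complex.exp ((ω - ν : ℝ) * x * Complex.I) • bohrComponent hH A ν := by
    rw [exp_conj_eq_sum_bohrComponent hH, Finset.smul_sum]
    refine Finset.sum_congr rfl fun ν _ => ?_
    rw [smul_smul, ← Complex.exp_add]
    congr 2
    push_cast
    ring
  have hnorm (x : ℝ) :
      ‖∑ ν ∈ bohrSet hH, Complex.exp ((ω - ν : ℝ) * x * Complex.I) • bohrComponent hH A ν‖ ≤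
        ‖A‖ := by
    have hphase : ‖Complex.exp (ω * x * Complex.I)‖ = 1 := by
      rw [← Complex.ofReal_mul, Complex.norm_exp_ofReal_mul_I]
    have hneg : -(((-x : ℝ) : ℂ) * Complex.I) = (x : ℂ) * Complex.I := by push_cast; ring
    rw [← hconj, norm_smul, hphase, one_mul, hneg,
      CStarRing.norm_mul_mem_unitary _ (exp_I_smul_mem_unitary hH x),
      CStarRing.norm_mem_unitary_mul _ (exp_I_smul_mem_unitary hH (-x))]
  have hint (s : ℝ) : Integrable (fun x : ℝ => Complex.exp (s * x * Complex.I)) γ := by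
    refine Integrable.of_bound (C := 1) (by fun_prop) (.of_forall fun x => ?_)
    rw [← Complex.ofReal_mul, Complex.norm_exp_ofReal_mul_I]
  have hoft : oft hH A σ ω = (c : ℂ) • ∫ x, ∑ ν ∈ bohrSet hH,
      Complex.exp ((ω - ν : ℝ) * x * Complex.I) • bohrComponent hH A ν ∂γ := by
    rw [integral_finsetSum _ fun ν _ => (hint _).smul_const _, Finset.smul_sum, oft]
    refine Finset.sum_congr rfl fun ν _ => ?_
    rw [integral_smul_const, smul_smul, gaussianWeight_eq_integral]
  have hc0 : 0 ≤ c := by positivity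
  rw [hoft, norm_smul, Complex.norm_real, Real.norm_of_nonneg hc0]
  refine mul_le_mul_of_nonneg_left ?_ hc0
  simpa using norm_integral_le_of_norm_le_const (μ := γ) (.of_forall hnorm)

/-- Norm bounds on imaginary-time conjugation: for the operator Fourier transform `Â(ω)` one has
`e^{βH} Â(ω) e^{−βH} = e^{βω} e^{σ²β²} Â(ω+2σ²β)`, and consequently, when `‖A‖ ≤ 1`,
`‖e^{βH} Â(ω) e^{−βH}‖ ≤ (e^{σ²β²}/√(σ√(2π))) e^{βω}` in the spectral norm. -/
theorem exp_conj_oft {n : ℕ} {H : Matrix (Fin n) (Fin n) ℂ} (hH : H.IsHermitian)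
    (A : Matrix (Fin n) (Fin n) ℂ) (σ : ℝ) (hσ : 0 < σ) (β ω : ℝ) :
    NormedSpace.exp ((β : ℂ) • H) * oft hH A σ ω * NormedSpace.exp (-(β : ℂ) • H) =
      ((Real.exp (β * ω) * Real.exp (σ ^ 2 * β ^ 2) : ℝ) : ℂ) •
        oft hH A σ (ω + 2 * σ ^ 2 * β) ∧
    (‖A‖ ≤ 1 →
      ‖NormedSpace.exp ((β : ℂ) • H) * oft hH A σ ω * NormedSpace.exp (-(β : ℂ) • H)‖ ≤
        Real.exp (σ ^ 2 * β ^ 2) / Real.sqrt (σ * Real.sqrt (2 * Real.pi)) *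
          Real.exp (β * ω)) := by
  have hconj : NormedSpace.exp ((β : ℂ) • H) * oft hH A σ ω * NormedSpace.exp (-(β : ℂ) • H) =
      ((Real.exp (β * ω) * Real.exp (σ ^ 2 * β ^ 2) : ℝ) : ℂ) •
        oft hH A σ (ω + 2 * σ ^ 2 * β) := by
    rw [oft, oft, Finset.mul_sum, Finset.sum_mul, Finset.smul_sum]
    refine Finset.sum_congr rfl fun ν _ => ?_
    rw [mul_smul_comm, smul_mul_assoc, exp_conj_bohrComponent, smul_smul, smul_smul,
      ← Complex.ofReal_mul, ← Complex.ofReal_mul, ← exp_mul_gaussianWeight σ hσ]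
    congr 1
    push_cast
    ring
  refine ⟨hconj, fun hA => ?_⟩
  rw [hconj, norm_smul, Complex.norm_real, Real.norm_of_nonneg (by positivity)]
  calc _ ≤ Real.exp (β * ω) * Real.exp (σ ^ 2 * β ^ 2) *
        ((Real.sqrt (σ * Real.sqrt (2 * Real.pi)))⁻¹ * 1) := by
        gcongr
        exact (norm_oft_le hH A σ _).trans (by gcongr)
    _ = _ := by ring
end

section
/- Let 𝒜 be a unital complex Banach algebra, H, A ∈ 𝒜, and c > 0 such that the iterated commutators satisfy ‖ad_H^k(A)‖ ≤ k! · c^k · ‖A‖ for every k ≥ 1, where ad_H(X) := HX − XH. Then for every real β with c·|β| < 1, the element exp(βH) A exp(−βH) satisfies ‖exp(βH) A exp(−βH)‖ ≤ ‖A‖ / (1 − c|β|). (In the paper, this hypothesis holds with c = 2d for a single-site operator A and a Hamiltonian H of interaction degree at most d, yielding ‖e^{βH} A e^{−βH}‖ ≤ 1/(1−2d|β|) for |β| < 1/(2d).) -/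
/-- The commutator map `ad_H : X ↦ HX − XH` in a ring. -/
def adjointAction {R : Type*} [Ring R] (H X : R) : R := H * X - X * H

open NormedSpace in
/-- The exponential of left multiplication by `x` is left multiplication by `exp x`. -/
theorem exp_mul_apply {𝒜 : Type*} [NormedRing 𝒜] [NormedAlgebra ℂ 𝒜] [CompleteSpace 𝒜]
    (x a : 𝒜) : exp (ContinuousLinearMap.mul ℂ 𝒜 x) a = exp x * a := by
  have h₁ := (exp_series_hasSum_exp' (𝕂 := ℂ) (ContinuousLinearMap.mul ℂ 𝒜 x)).mapL
    (ContinuousLinearMap.apply ℂ 𝒜 a)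
  have h₂ := (exp_series_hasSum_exp' (𝕂 := ℂ) x).mul_right a
  have hpow (n : ℕ) : ((ContinuousLinearMap.mul ℂ 𝒜 x) ^ n) a = x ^ n * a := by
    induction n with
    | zero => simp
    | succ n ih => rw [pow_succ', mul_apply_eq_comp, ih]; simp [pow_succ', mul_assoc]
  exact h₁.unique (by simpa [hpow] using h₂)

open NormedSpace in
/-- The exponential of right multiplication by `x` is right multiplication by `exp x`. -/
theorem exp_mul_flip_apply {𝒜 : Type*} [NormedRing 𝒜] [NormedAlgebra ℂ 𝒜] [CompleteSpace 𝒜]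
    (x a : 𝒜) : exp ((ContinuousLinearMap.mul ℂ 𝒜).flip x) a = a * exp x := by
  have h₁ := (exp_series_hasSum_exp' (𝕂 := ℂ) ((ContinuousLinearMap.mul ℂ 𝒜).flip x)).mapL
    (ContinuousLinearMap.apply ℂ 𝒜 a)
  have h₂ := (exp_series_hasSum_exp' (𝕂 := ℂ) x).mul_left a
  have hpow (n : ℕ) : (((ContinuousLinearMap.mul ℂ 𝒜).flip x) ^ n) a = a * x ^ n := by
    induction n with
    | zero => simp
    | succ n ih => rw [pow_succ', mul_apply_eq_comp, ih]; simp [pow_succ, mul_assoc]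
  exact h₁.unique (by simpa [hpow] using h₂)

open NormedSpace in
/-- The expansion of conjugation by `exp x` in iterated commutators. -/
theorem hasSum_adjointAction_iterate {𝒜 : Type*} [NormedRing 𝒜] [NormedAlgebra ℂ 𝒜]
    [CompleteSpace 𝒜] (x a : 𝒜) :
    HasSum (fun k : ℕ => ((k.factorial : ℂ)⁻¹) • (adjointAction x)^[k] a)
      (exp x * a * exp (-x)) := by
  let L := ContinuousLinearMap.mul ℂ 𝒜 x
  let R := (ContinuousLinearMap.mul ℂ 𝒜).flip (-x)
  have hcomm : Commute L R := by
    ext y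
    simp [L, R, mul_assoc]
  let : NormedAlgebra ℚ (𝒜 →L[ℂ] 𝒜) := NormedAlgebra.restrictScalars ℚ ℂ _
  have hexp : exp (L + R) a = exp x * a * exp (-x) := by
    rw [exp_add_of_commute hcomm, mul_apply_eq_comp, exp_mul_flip_apply,
      exp_mul_apply, mul_assoc]
  have hpow (k : ℕ) : ((L + R) ^ k) a = (adjointAction x)^[k] a := by
    induction k with
    | zero => simp
    | succ k ih =>
      rw [pow_succ', mul_apply_eq_comp, ih, Function.iterate_succ_apply']
      simp [L, R, adjointAction, sub_eq_add_neg]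
  have h := (exp_series_hasSum_exp' (𝕂 := ℂ) (L + R)).mapL (ContinuousLinearMap.apply ℂ 𝒜 a)
  simpa [hpow, hexp] using h

theorem adjointAction_smul_iterate {𝕜 R : Type*} [CommSemiring 𝕜] [Ring R] [Algebra 𝕜 R]
    (t : 𝕜) (x a : R) (k : ℕ) :
    (adjointAction (t • x))^[k] a = t ^ k • (adjointAction x)^[k] a := by
  induction k with
  | zero => simp
  | succ k ih =>
    rw [Function.iterate_succ_apply', Function.iterate_succ_apply', ih]
    simp [adjointAction, smul_sub, smul_smul, pow_succ, mul_comm]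

/-- Convergence of imaginary-time conjugation: if the iterated commutators satisfy
`‖ad_H^k(A)‖ ≤ k! c^k ‖A‖` for all `k ≥ 1`, then for `c|β| < 1` one has
`‖e^{βH} A e^{−βH}‖ ≤ ‖A‖/(1 − c|β|)`. -/
theorem norm_exp_conj_le {𝒜 : Type*} [NormedRing 𝒜] [NormedAlgebra ℂ 𝒜] [CompleteSpace 𝒜]
    (H A : 𝒜) (c : ℝ) (hc : 0 < c)
    (had : ∀ k : ℕ, 1 ≤ k →
      ‖(adjointAction H)^[k] A‖ ≤ (k.factorial : ℝ) * c ^ k * ‖A‖)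
    (β : ℝ) (hβ : c * |β| < 1) :
    ‖NormedSpace.exp ((β : ℂ) • H) * A * NormedSpace.exp (-(β : ℂ) • H)‖ ≤
      ‖A‖ / (1 - c * |β|) := by
  have hgeom : HasSum (fun k : ℕ => (c * |β|) ^ k * ‖A‖) (‖A‖ / (1 - c * |β|)) := by
    rw [div_eq_inv_mul]
    exact (hasSum_geometric_of_lt_one (by positivity) hβ).mul_right _
  have hsum := hasSum_adjointAction_iterate ((β : ℂ) • H) A
  rw [neg_smul, ← hsum.tsum_eq]
  refine tsum_of_norm_bounded hgeom fun k => ?_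
  have hk : ‖(adjointAction H)^[k] A‖ ≤ (k.factorial : ℝ) * c ^ k * ‖A‖ := by
    rcases k.eq_zero_or_pos with rfl | hpos
    · simp
    · exact had k hpos
  rw [adjointAction_smul_iterate, norm_smul, norm_smul, norm_inv, norm_pow, Complex.norm_real,
    Complex.norm_natCast, Real.norm_eq_abs]
  calc (k.factorial : ℝ)⁻¹ * (|β| ^ k * ‖(adjointAction H)^[k] A‖)
      ≤ (k.factorial : ℝ)⁻¹ * (|β| ^ k * ((k.factorial : ℝ) * c ^ k * ‖A‖)) := by gcongr
    _ = (c * |β|) ^ k * ‖A‖ := by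
      have : (k.factorial : ℝ) ≠ 0 := by positivity
      field_simp
      ring
end

section
/- Let ρ be a positive definite complex n×n matrix and A, O arbitrary n×n complex matrices. With the KMS norm ‖X‖_ρ := √(Tr[X† ρ^{1/2} X ρ^{1/2}]), one has ‖A·O‖_ρ ≤ ‖ρ^{1/4} A ρ^{−1/4}‖ · ‖O‖_ρ and ‖O·A‖_ρ ≤ ‖ρ^{−1/4} A ρ^{1/4}‖ · ‖O‖_ρ, and consequently ‖[A,O]‖_ρ ≤ (‖ρ^{1/4} A ρ^{−1/4}‖ + ‖ρ^{−1/4} A ρ^{1/4}‖) · ‖O‖_ρ, where ρ^{±1/4} are the real powers of the positive definite matrix ρ, [A,O] := AO − OA, and ‖·‖ is the operator (spectral) norm. -/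
open scoped Matrix.Norms.L2Operator ComplexOrder Matrix

/-- The real power `ρ^r` of a positive definite matrix `ρ`, defined by functional calculus
via the spectral decomposition of `ρ`. -/
noncomputable def posDefRpow {n : ℕ} {ρ : Matrix (Fin n) (Fin n) ℂ} (hρ : ρ.PosDef) (r : ℝ) :
    Matrix (Fin n) (Fin n) ℂ :=
  (hρ.1.eigenvectorUnitary : Matrix (Fin n) (Fin n) ℂ) *
    Matrix.diagonal (fun i => ((hρ.1.eigenvalues i ^ r : ℝ) : ℂ)) *
    (star (hρ.1.eigenvectorUnitary : Matrix (Fin n) (Fin n) ℂ))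

/-- The KMS norm `‖X‖_ρ := √(Tr[X† ρ^{1/2} X ρ^{1/2}])` for a positive definite `ρ`. -/
noncomputable def kmsNormPD {n : ℕ} {ρ : Matrix (Fin n) (Fin n) ℂ} (hρ : ρ.PosDef)
    (X : Matrix (Fin n) (Fin n) ℂ) : ℝ :=
  Real.sqrt ((Xᴴ * posDefRpow hρ (1/2) * X * posDefRpow hρ (1/2)).trace.re)

/-- The Hilbert–Schmidt norm of a matrix, as the Euclidean norm of its vector of entries. -/
noncomputable def hilbertSchmidtNorm {n : ℕ} (X : Matrix (Fin n) (Fin n) ℂ) : ℝ :=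
  ‖(WithLp.toLp 2 (fun p : Fin n × Fin n => X p.1 p.2) : EuclideanSpace ℂ (Fin n × Fin n))‖

theorem hilbertSchmidtNorm_nonneg {n : ℕ} (X : Matrix (Fin n) (Fin n) ℂ) :
    0 ≤ hilbertSchmidtNorm X :=
  norm_nonneg _

theorem hilbertSchmidtNorm_sub_le {n : ℕ} (X Y : Matrix (Fin n) (Fin n) ℂ) :
    hilbertSchmidtNorm (X - Y) ≤ hilbertSchmidtNorm X + hilbertSchmidtNorm Y :=
  norm_sub_le (WithLp.toLp 2 (fun p : Fin n × Fin n => X p.1 p.2) :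
    EuclideanSpace ℂ (Fin n × Fin n)) (WithLp.toLp 2 (fun p : Fin n × Fin n => Y p.1 p.2))

theorem hilbertSchmidtNorm_sq {n : ℕ} (X : Matrix (Fin n) (Fin n) ℂ) :
    hilbertSchmidtNorm X ^ 2 = ∑ j, ∑ i, ‖X i j‖ ^ 2 := by
  rw [hilbertSchmidtNorm, EuclideanSpace.norm_sq_eq, Fintype.sum_prod_type_right]

theorem hilbertSchmidtNorm_conjTranspose {n : ℕ} (X : Matrix (Fin n) (Fin n) ℂ) :
    hilbertSchmidtNorm Xᴴ = hilbertSchmidtNorm X := by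
  rw [← sq_eq_sq₀ (hilbertSchmidtNorm_nonneg _) (hilbertSchmidtNorm_nonneg _),
    hilbertSchmidtNorm_sq, hilbertSchmidtNorm_sq, Finset.sum_comm]
  simp

theorem sqrt_re_trace_conjTranspose_mul_self {n : ℕ} (X : Matrix (Fin n) (Fin n) ℂ) :
    Real.sqrt ((Xᴴ * X).trace.re) = hilbertSchmidtNorm X := by
  rw [← Real.sqrt_sq (hilbertSchmidtNorm_nonneg X), hilbertSchmidtNorm_sq]
  simp [Matrix.trace, Matrix.mul_apply, Complex.conj_mul', ← Complex.ofReal_pow]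

theorem hilbertSchmidtNorm_mul_le_opNorm_mul {n : ℕ} (A X : Matrix (Fin n) (Fin n) ℂ) :
    hilbertSchmidtNorm (A * X) ≤ ‖A‖ * hilbertSchmidtNorm X := by
  refine le_of_sq_le_sq ?_ (mul_nonneg (norm_nonneg _) (hilbertSchmidtNorm_nonneg _))
  rw [mul_pow, hilbertSchmidtNorm_sq, hilbertSchmidtNorm_sq, Finset.mul_sum]
  refine Finset.sum_le_sum fun j _ => ?_
  have h := pow_le_pow_left₀ (norm_nonneg _)
    (A.l2_opNorm_mulVec (WithLp.toLp 2 (fun i => X i j))) 2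
  rw [mul_pow, EuclideanSpace.norm_sq_eq, EuclideanSpace.norm_sq_eq] at h
  exact h

theorem hilbertSchmidtNorm_mul_le_mul_opNorm {n : ℕ} (A X : Matrix (Fin n) (Fin n) ℂ) :
    hilbertSchmidtNorm (X * A) ≤ ‖A‖ * hilbertSchmidtNorm X := by
  rw [← hilbertSchmidtNorm_conjTranspose (X * A), ← hilbertSchmidtNorm_conjTranspose X,
    ← Matrix.l2_opNorm_conjTranspose A, Matrix.conjTranspose_mul]
  exact hilbertSchmidtNorm_mul_le_opNorm_mul _ _

theorem posDefRpow_mul_posDefRpow {n : ℕ} {ρ : Matrix (Fin n) (Fin n) ℂ} (hρ : ρ.PosDef)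
    (r s : ℝ) : posDefRpow hρ r * posDefRpow hρ s = posDefRpow hρ (r + s) := by
  have hU : star (hρ.1.eigenvectorUnitary : Matrix (Fin n) (Fin n) ℂ) *
      (hρ.1.eigenvectorUnitary : Matrix (Fin n) (Fin n) ℂ) = 1 :=
    Unitary.coe_star_mul_self _
  have hD : (fun i => ((hρ.1.eigenvalues i ^ (r + s) : ℝ) : ℂ)) = fun i =>
      ((hρ.1.eigenvalues i ^ r : ℝ) : ℂ) * ((hρ.1.eigenvalues i ^ s : ℝ) : ℂ) := by
    funext i
    rw [Real.rpow_add (hρ.eigenvalues_pos i), Complex.ofReal_mul]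
  simp only [posDefRpow]
  rw [hD, ← Matrix.diagonal_mul_diagonal]
  simp only [Matrix.mul_assoc]
  rw [← Matrix.mul_assoc (star _) _ (_ * _), hU, Matrix.one_mul]

theorem posDefRpow_zero {n : ℕ} {ρ : Matrix (Fin n) (Fin n) ℂ} (hρ : ρ.PosDef) :
    posDefRpow hρ 0 = 1 := by
  simp [posDefRpow]

theorem conjTranspose_posDefRpow {n : ℕ} {ρ : Matrix (Fin n) (Fin n) ℂ} (hρ : ρ.PosDef)
    (r : ℝ) : (posDefRpow hρ r)ᴴ = posDefRpow hρ r := by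
  have hD : star (fun i => ((hρ.1.eigenvalues i ^ r : ℝ) : ℂ)) =
      fun i => ((hρ.1.eigenvalues i ^ r : ℝ) : ℂ) := by
    funext i
    simp
  simp only [posDefRpow, Matrix.star_eq_conjTranspose, Matrix.conjTranspose_mul,
    Matrix.conjTranspose_conjTranspose, Matrix.diagonal_conjTranspose, hD, Matrix.mul_assoc]

theorem posDefRpow_neg_mul_self {n : ℕ} {ρ : Matrix (Fin n) (Fin n) ℂ} (hρ : ρ.PosDef)
    (r : ℝ) : posDefRpow hρ (-r) * posDefRpow hρ r = 1 := by
  rw [posDefRpow_mul_posDefRpow, neg_add_cancel, posDefRpow_zero]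

theorem posDefRpow_mul_neg_self {n : ℕ} {ρ : Matrix (Fin n) (Fin n) ℂ} (hρ : ρ.PosDef)
    (r : ℝ) : posDefRpow hρ r * posDefRpow hρ (-r) = 1 := by
  rw [posDefRpow_mul_posDefRpow, add_neg_cancel, posDefRpow_zero]

theorem kmsNormPD_eq_hilbertSchmidtNorm {n : ℕ} {ρ : Matrix (Fin n) (Fin n) ℂ} (hρ : ρ.PosDef)
    (X : Matrix (Fin n) (Fin n) ℂ) : kmsNormPD hρ X =
      hilbertSchmidtNorm (posDefRpow hρ (1/4) * X * posDefRpow hρ (1/4)) := by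
  have hQ : posDefRpow hρ (1/2) = posDefRpow hρ (1/4) * posDefRpow hρ (1/4) := by
    rw [posDefRpow_mul_posDefRpow]
    norm_num
  rw [← sqrt_re_trace_conjTranspose_mul_self, kmsNormPD, hQ, ← Matrix.mul_assoc,
    Matrix.trace_mul_comm]
  simp only [Matrix.conjTranspose_mul, conjTranspose_posDefRpow, Matrix.mul_assoc]

theorem kmsNormPD_sub_le {n : ℕ} {ρ : Matrix (Fin n) (Fin n) ℂ} (hρ : ρ.PosDef)
    (X Y : Matrix (Fin n) (Fin n) ℂ) :
    kmsNormPD hρ (X - Y) ≤ kmsNormPD hρ X + kmsNormPD hρ Y := by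
  simp only [kmsNormPD_eq_hilbertSchmidtNorm, Matrix.mul_sub, Matrix.sub_mul]
  exact hilbertSchmidtNorm_sub_le _ _

theorem kmsNormPD_mul_le_left {n : ℕ} {ρ : Matrix (Fin n) (Fin n) ℂ} (hρ : ρ.PosDef)
    (A O : Matrix (Fin n) (Fin n) ℂ) : kmsNormPD hρ (A * O) ≤
      ‖posDefRpow hρ (1/4) * A * posDefRpow hρ (-(1/4))‖ * kmsNormPD hρ O := by
  rw [kmsNormPD_eq_hilbertSchmidtNorm, kmsNormPD_eq_hilbertSchmidtNorm]
  convert hilbertSchmidtNorm_mul_le_opNorm_mul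
    (posDefRpow hρ (1/4) * A * posDefRpow hρ (-(1/4)))
    (posDefRpow hρ (1/4) * O * posDefRpow hρ (1/4)) using 2
  simp only [Matrix.mul_assoc]
  rw [← Matrix.mul_assoc (posDefRpow hρ (-(1/4))), posDefRpow_neg_mul_self, Matrix.one_mul]

theorem kmsNormPD_mul_le_right {n : ℕ} {ρ : Matrix (Fin n) (Fin n) ℂ} (hρ : ρ.PosDef)
    (A O : Matrix (Fin n) (Fin n) ℂ) : kmsNormPD hρ (O * A) ≤
      ‖posDefRpow hρ (-(1/4)) * A * posDefRpow hρ (1/4)‖ * kmsNormPD hρ O := by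
  rw [kmsNormPD_eq_hilbertSchmidtNorm, kmsNormPD_eq_hilbertSchmidtNorm]
  convert hilbertSchmidtNorm_mul_le_mul_opNorm
    (posDefRpow hρ (-(1/4)) * A * posDefRpow hρ (1/4))
    (posDefRpow hρ (1/4) * O * posDefRpow hρ (1/4)) using 2
  simp only [Matrix.mul_assoc]
  rw [← Matrix.mul_assoc (posDefRpow hρ (1/4)) (posDefRpow hρ (-(1/4))),
    posDefRpow_mul_neg_self, Matrix.one_mul]

/-- Hölder-type bounds for the KMS norm: `‖AO‖_ρ ≤ ‖ρ^{1/4}Aρ^{−1/4}‖ ‖O‖_ρ`,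
`‖OA‖_ρ ≤ ‖ρ^{−1/4}Aρ^{1/4}‖ ‖O‖_ρ`, and consequently
`‖[A,O]‖_ρ ≤ (‖ρ^{1/4}Aρ^{−1/4}‖ + ‖ρ^{−1/4}Aρ^{1/4}‖) ‖O‖_ρ`, with `‖·‖` the spectral norm. -/
theorem kmsNorm_mul_le {n : ℕ} {ρ : Matrix (Fin n) (Fin n) ℂ} (hρ : ρ.PosDef)
    (A O : Matrix (Fin n) (Fin n) ℂ) :
    kmsNormPD hρ (A * O) ≤
        ‖posDefRpow hρ (1/4) * A * posDefRpow hρ (-(1/4))‖ * kmsNormPD hρ O ∧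
    kmsNormPD hρ (O * A) ≤
        ‖posDefRpow hρ (-(1/4)) * A * posDefRpow hρ (1/4)‖ * kmsNormPD hρ O ∧
    kmsNormPD hρ (A * O - O * A) ≤
        (‖posDefRpow hρ (1/4) * A * posDefRpow hρ (-(1/4))‖ +
          ‖posDefRpow hρ (-(1/4)) * A * posDefRpow hρ (1/4)‖) * kmsNormPD hρ O := by
  refine ⟨kmsNormPD_mul_le_left hρ A O, kmsNormPD_mul_le_right hρ A O, ?_⟩
  rw [add_mul]
  exact (kmsNormPD_sub_le hρ _ _).trans
    (add_le_add (kmsNormPD_mul_le_left hρ A O) (kmsNormPD_mul_le_right hρ A O))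
end

section
/- There is an absolute constant C > 0 with the following property. Let H be a Hermitian n×n complex matrix, σ > 0, and β, β₀ real with β > 4β₀ > 0; set β' := β/4 − β₀ and let ρ_s := exp(−sH)/Tr[exp(−sH)] denote the Gibbs state at inverse temperature s. Then for all n×n complex matrices A, O with ‖A‖ ≤ 1 and ‖O‖ ≤ 1, both ‖A·O‖_{ρ_β} and ‖O·A‖_{ρ_β} are at most C · (e^{σ²β'²}/(β'σ) + e^{σ²β₀²}/(β₀σ)) · ‖O‖_{ρ_β}^{4β₀/β} · (‖ρ_{β₀} A ρ_{β₀}^{−1}‖ + ‖ρ_{β₀}^{−1} A ρ_{β₀}‖), where ‖X‖_{ρ} := √(Tr[X† ρ^{1/2} X ρ^{1/2}]) is the KMS norm and ‖·‖ the operator (spectral) norm. -/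
open scoped Matrix.Norms.L2Operator ComplexOrder Matrix

noncomputable section

/-- The Gibbs state `ρ_s := e^{−sH}/Tr[e^{−sH}]` at inverse temperature `s`. -/
def gibbs {n : ℕ} (H : Matrix (Fin n) (Fin n) ℂ) (s : ℝ) : Matrix (Fin n) (Fin n) ℂ :=
  ((NormedSpace.exp ((-s : ℂ) • H)).trace)⁻¹ • NormedSpace.exp ((-s : ℂ) • H)

/-- The positive semidefinite square root `ρ_s^{1/2} = e^{−(s/2)H}/√(Tr[e^{−sH}])` of the
Gibbs state of a Hermitian `H`. -/
def gibbsSqrt {n : ℕ} (H : Matrix (Fin n) (Fin n) ℂ) (s : ℝ) : Matrix (Fin n) (Fin n) ℂ :=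
  (((Real.sqrt ((NormedSpace.exp ((-s : ℂ) • H)).trace.re) : ℝ) : ℂ))⁻¹ •
    NormedSpace.exp ((-(s / 2) : ℂ) • H)

/-- The KMS norm `‖X‖_{ρ_s} := √(Tr[X† ρ_s^{1/2} X ρ_s^{1/2}])` weighted by the Gibbs state. -/
def kmsNormGibbs {n : ℕ} (H : Matrix (Fin n) (Fin n) ℂ) (s : ℝ)
    (X : Matrix (Fin n) (Fin n) ℂ) : ℝ :=
  Real.sqrt ((Xᴴ * gibbsSqrt H s * X * gibbsSqrt H s).trace.re)

end

noncomputable section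

open Complex

/-- The entries of a square matrix as a vector of a Euclidean space, so that the norm of
`entriesVec X` is the Hilbert–Schmidt norm of `X`. -/
def entriesVec {n : ℕ} : Matrix (Fin n) (Fin n) ℂ →ₗ[ℂ] EuclideanSpace ℂ (Fin n × Fin n) where
  toFun X := WithLp.toLp 2 fun p => X p.1 p.2
  map_add' _ _ := rfl
  map_smul' _ _ := rfl

lemma inner_entriesVec {n : ℕ} (X Y : Matrix (Fin n) (Fin n) ℂ) :
    inner ℂ (entriesVec X) (entriesVec Y) = (Xᴴ * Y).trace := by
  simp only [entriesVec, PiLp.inner_apply, RCLike.inner_apply,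
    Fintype.sum_prod_type, Matrix.trace, Matrix.diag, Matrix.mul_apply, Matrix.conjTranspose_apply,
    RCLike.star_def]
  rw [Finset.sum_comm]
  exact Finset.sum_congr rfl fun _ _ => Finset.sum_congr rfl fun _ _ => mul_comm _ _

lemma norm_entriesVec_sq {n : ℕ} (X : Matrix (Fin n) (Fin n) ℂ) :
    ‖entriesVec X‖ ^ 2 = (Xᴴ * X).trace.re := by
  rw [← inner_entriesVec, inner_self_eq_norm_sq_to_K]
  norm_cast

lemma norm_entriesVec_conjTranspose {n : ℕ} (X : Matrix (Fin n) (Fin n) ℂ) :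
    ‖entriesVec Xᴴ‖ = ‖entriesVec X‖ := by
  rw [← sq_eq_sq₀ (norm_nonneg _) (norm_nonneg _), norm_entriesVec_sq, norm_entriesVec_sq,
    Matrix.conjTranspose_conjTranspose, Matrix.trace_mul_comm]

lemma norm_entriesVec_mul_le {n : ℕ} (M X : Matrix (Fin n) (Fin n) ℂ) :
    ‖entriesVec (M * X)‖ ≤ ‖M‖ * ‖entriesVec X‖ := by
  have hcol (Y : Matrix (Fin n) (Fin n) ℂ) : ‖entriesVec Y‖ ^ 2 =
      ∑ j, ‖(WithLp.toLp 2 fun i => Y i j : EuclideanSpace ℂ (Fin n))‖ ^ 2 := by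
    simp only [EuclideanSpace.norm_sq_eq, Fintype.sum_prod_type, entriesVec]
    exact Finset.sum_comm
  rw [← sq_le_sq₀ (norm_nonneg _) (by positivity), mul_pow, hcol, hcol, Finset.mul_sum]
  refine Finset.sum_le_sum fun j _ => ?_
  rw [← mul_pow]
  exact pow_le_pow_left₀ (norm_nonneg _)
    (M.l2_opNorm_mulVec (WithLp.toLp 2 fun i => X i j)) 2

lemma norm_entriesVec_mul_le' {n : ℕ} (X M : Matrix (Fin n) (Fin n) ℂ) :
    ‖entriesVec (X * M)‖ ≤ ‖entriesVec X‖ * ‖M‖ := by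
  have h := norm_entriesVec_mul_le Mᴴ Xᴴ
  rwa [← Matrix.conjTranspose_mul, norm_entriesVec_conjTranspose, norm_entriesVec_conjTranspose,
    Matrix.l2_opNorm_conjTranspose, mul_comm] at h

/-- The complex power `e^{zH}` of the matrix `e^H`. -/
def expSmul {n : ℕ} (H : Matrix (Fin n) (Fin n) ℂ) (z : ℂ) : Matrix (Fin n) (Fin n) ℂ :=
  NormedSpace.exp (z • H)

section expSmul

variable {n : ℕ} {H : Matrix (Fin n) (Fin n) ℂ}

lemma expSmul_zero : expSmul H 0 = 1 := by
  simp [expSmul]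

lemma expSmul_mul_expSmul (z w : ℂ) : expSmul H z * expSmul H w = expSmul H (z + w) := by
  rw [expSmul, expSmul, expSmul, add_smul, Matrix.exp_add_of_commute]
  exact ((Commute.refl H).smul_left z).smul_right w

lemma expSmul_mul_cancel_left (z : ℂ) (X : Matrix (Fin n) (Fin n) ℂ) :
    expSmul H z * (expSmul H (-z) * X) = X := by
  rw [← mul_assoc, expSmul_mul_expSmul, add_neg_cancel, expSmul_zero, one_mul]

lemma conjTranspose_expSmul (hH : H.IsHermitian) (z : ℂ) :
    (expSmul H z)ᴴ = expSmul H (starRingEnd ℂ z) := by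
  rw [expSmul, expSmul, ← Matrix.exp_conjTranspose, Matrix.conjTranspose_smul, hH.eq]
  rfl

lemma isHermitian_expSmul (hH : H.IsHermitian) {z : ℂ} (hz : z.im = 0) :
    (expSmul H z).IsHermitian := by
  rw [Matrix.IsHermitian, conjTranspose_expSmul hH, conj_eq_iff_im.mpr hz]

lemma differentiable_expSmul : Differentiable ℂ (expSmul H) :=
  fun z => (hasDerivAt_exp_smul_const H z).differentiableAt

lemma norm_expSmul_le (hH : H.IsHermitian) (z : ℂ) : ‖expSmul H z‖ ≤ ‖expSmul H z.re‖ := by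
  refine le_of_sq_le_sq ?_ (norm_nonneg _)
  rw [sq, sq, ← Matrix.l2_opNorm_conjTranspose_mul_self, ← Matrix.l2_opNorm_conjTranspose_mul_self,
    conjTranspose_expSmul hH, conjTranspose_expSmul hH, expSmul_mul_expSmul, expSmul_mul_expSmul]
  simp [add_comm, Complex.add_conj, two_mul]

lemma norm_expSmul_le_one (hH : H.IsHermitian) {z : ℂ} (hz : z.re = 0) : ‖expSmul H z‖ ≤ 1 := by
  refine (norm_expSmul_le hH z).trans ?_
  rw [hz, ofReal_zero, expSmul_zero]
  have h := Matrix.l2_opNorm_conjTranspose_mul_self (1 : Matrix (Fin n) (Fin n) ℂ)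
  rw [Matrix.conjTranspose_one, one_mul] at h
  nlinarith [norm_nonneg (1 : Matrix (Fin n) (Fin n) ℂ)]

lemma trace_expSmul_eq (hH : H.IsHermitian) (s : ℝ) :
    (expSmul H (-s)).trace.re = ‖entriesVec (expSmul H (-(s / 2)))‖ ^ 2 := by
  rw [norm_entriesVec_sq, conjTranspose_expSmul hH, expSmul_mul_expSmul]
  congr 4
  simp only [map_neg, map_div₀, conj_ofReal, Complex.conj_ofNat]
  ring

lemma norm_entriesVec_conj_sq (hH : H.IsHermitian) (s : ℝ) (X : Matrix (Fin n) (Fin n) ℂ) :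
    ‖entriesVec (expSmul H (-(s / 4)) * X * expSmul H (-(s / 4)))‖ ^ 2 =
      (Xᴴ * expSmul H (-(s / 2)) * X * expSmul H (-(s / 2))).trace.re := by
  have hs : expSmul H (-(s / 2)) = expSmul H (-(s / 4)) * expSmul H (-(s / 4)) := by
    rw [expSmul_mul_expSmul]
    congr 1
    ring
  have hc : (expSmul H (-(s / 4))).IsHermitian := isHermitian_expSmul hH (by simp)
  rw [norm_entriesVec_sq, hs, Matrix.conjTranspose_mul, Matrix.conjTranspose_mul, hc.eq]
  simp only [mul_assoc]
  rw [Matrix.trace_mul_comm]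
  simp only [mul_assoc]

lemma norm_entriesVec_conj_le (hH : H.IsHermitian) (s : ℝ) (X : Matrix (Fin n) (Fin n) ℂ) :
    ‖entriesVec (expSmul H (-(s / 4)) * X * expSmul H (-(s / 4)))‖ ≤
      ‖X‖ * ‖entriesVec (expSmul H (-(s / 2)))‖ := by
  refine le_of_sq_le_sq ?_ (by positivity)
  have hc : (expSmul H (-(s / 2))).IsHermitian := isHermitian_expSmul hH (by simp)
  have hcs := (re_le_norm _).trans
    (norm_inner_le_norm (𝕜 := ℂ) (entriesVec (expSmul H (-(s / 2)) * X))
      (entriesVec (X * expSmul H (-(s / 2)))))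
  rw [inner_entriesVec, Matrix.conjTranspose_mul, hc.eq, ← mul_assoc] at hcs
  rw [norm_entriesVec_conj_sq hH]
  refine hcs.trans ?_
  calc _ ≤ (‖entriesVec (expSmul H (-(s / 2)))‖ * ‖X‖) *
        (‖X‖ * ‖entriesVec (expSmul H (-(s / 2)))‖) :=
        mul_le_mul (norm_entriesVec_mul_le' _ _) (norm_entriesVec_mul_le _ _)
          (norm_nonneg _) (by positivity)
    _ = _ := by ring

lemma kmsNormGibbs_eq (hH : H.IsHermitian) (s : ℝ) (X : Matrix (Fin n) (Fin n) ℂ) :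
    kmsNormGibbs H s X =
      ‖entriesVec (expSmul H (-(s / 4)) * X * expSmul H (-(s / 4)))‖ /
        ‖entriesVec (expSmul H (-(s / 2)))‖ := by
  have hsqrt : gibbsSqrt H s =
      ((‖entriesVec (expSmul H (-(s / 2)))‖⁻¹ : ℝ) : ℂ) • expSmul H (-(s / 2)) := by
    have h := trace_expSmul_eq hH s
    rw [expSmul] at h
    rw [gibbsSqrt, h, Real.sqrt_sq (norm_nonneg _), ofReal_inv]
    rfl
  rw [kmsNormGibbs, hsqrt, Matrix.mul_smul, Matrix.mul_smul, Matrix.smul_mul, Matrix.smul_mul,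
    smul_smul, ← ofReal_mul, Matrix.trace_smul, smul_eq_mul, re_ofReal_mul,
    ← norm_entriesVec_conj_sq hH, ← sq, ← mul_pow, Real.sqrt_sq (by positivity)]
  ring

lemma kmsNormGibbs_conjTranspose (hH : H.IsHermitian) (s : ℝ) (X : Matrix (Fin n) (Fin n) ℂ) :
    kmsNormGibbs H s Xᴴ = kmsNormGibbs H s X := by
  have hc : (expSmul H (-(s / 4))).IsHermitian := isHermitian_expSmul hH (by simp)
  rw [kmsNormGibbs_eq hH, kmsNormGibbs_eq hH, ← norm_entriesVec_conjTranspose,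
    Matrix.conjTranspose_mul, Matrix.conjTranspose_mul, hc.eq, Matrix.conjTranspose_conjTranspose,
    mul_assoc]

lemma norm_entriesVec_expSmul_pos [NeZero n] (z : ℂ) : 0 < ‖entriesVec (expSmul H z)‖ := by
  rw [norm_pos_iff]
  intro h
  have h0 : expSmul H z = 0 := by
    ext i j
    exact congrArg (fun v : EuclideanSpace ℂ (Fin n × Fin n) => v (i, j)) h
  have h1 := expSmul_mul_cancel_left (H := H) z 1
  rw [h0, zero_mul] at h1
  exact zero_ne_one h1

lemma gibbs_conj_eq [NeZero n] (hH : H.IsHermitian) (s : ℝ) (A : Matrix (Fin n) (Fin n) ℂ) :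
    gibbs H s * A * (gibbs H s)⁻¹ = expSmul H (-s) * A * expSmul H s ∧
      (gibbs H s)⁻¹ * A * gibbs H s = expSmul H s * A * expSmul H (-s) := by
  have htr : (expSmul H (-s)).trace ≠ 0 := by
    intro h
    have h1 := trace_expSmul_eq hH s
    rw [h, zero_re] at h1
    exact (pow_pos (norm_entriesVec_expSmul_pos (H := H) (-(s / 2))) 2).ne h1
  have hg : gibbs H s = (expSmul H (-s)).trace⁻¹ • expSmul H (-s) := rfl
  have hinv : (gibbs H s)⁻¹ = (expSmul H (-s)).trace • expSmul H s := by
    refine Matrix.inv_eq_right_inv ?_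
    rw [hg, Matrix.smul_mul, Matrix.mul_smul, smul_smul, inv_mul_cancel₀ htr, one_smul,
      expSmul_mul_expSmul, neg_add_cancel, expSmul_zero]
  rw [hinv, hg]
  simp only [Matrix.smul_mul, Matrix.mul_smul, smul_smul, inv_mul_cancel₀ htr,
    mul_inv_cancel₀ htr, one_smul, and_self]

/-- Interpolation between `θ = 0`, where the left side is at most `‖B‖ ‖O‖ (Tr e^{-sH})^{1/2}`, and
`θ = 1`, where it is at most `‖B‖` times the unnormalized KMS norm of `O`. -/
lemma norm_entriesVec_interp_le (hH : H.IsHermitian) (s : ℝ) {θ : ℝ} (h0 : 0 ≤ θ) (h1 : θ ≤ 1)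
    (B O : Matrix (Fin n) (Fin n) ℂ) (hO : ‖O‖ ≤ 1) :
    ‖entriesVec (expSmul H (-((1 - θ) * (s / 4))) * B * expSmul H (-(θ * (s / 4))) * O *
        expSmul H (-(s / 4)))‖ ≤
      (‖B‖ * ‖entriesVec (expSmul H (-(s / 2)))‖) ^ (1 - θ) *
        (‖B‖ * ‖entriesVec (expSmul H (-(s / 4)) * O * expSmul H (-(s / 4)))‖) ^ θ := by
  let f : ℂ → EuclideanSpace ℂ (Fin n × Fin n) := fun z =>
    entriesVec (expSmul H (-((1 - z) * (s / 4))) * B * expSmul H (-(z * (s / 4))) * O *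
        expSmul H (-(s / 4)))
  have hf : Differentiable ℂ f := by
    have hL : Differentiable ℂ (entriesVec (n := n)) :=
      (LinearMap.toContinuousLinearMap (entriesVec (n := n))).differentiable
    have hl : Differentiable ℂ fun z : ℂ => expSmul H (-((1 - z) * (s / 4))) :=
      differentiable_expSmul.comp (by fun_prop)
    have hr : Differentiable ℂ fun z : ℂ => expSmul H (-(z * (s / 4))) :=
      differentiable_expSmul.comp (by fun_prop)
    exact hL.comp ((((hl.mul_const B).mul hr).mul_const O).mul_const _)
  have hbdd : BddAbove ((norm ∘ f) '' HadamardThreeLines.verticalClosedStrip 0 1) := by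
    let g : ℝ → ℝ := fun x => ‖expSmul H (-((1 - (x : ℂ)) * (s / 4)))‖ * ‖B‖ *
      ‖expSmul H (-((x : ℂ) * (s / 4)))‖ * ‖O‖ * ‖entriesVec (expSmul H (-(s / 4)))‖
    have he : Continuous (expSmul H) := differentiable_expSmul.continuous
    have hg : Continuous g := by fun_prop
    obtain ⟨K, hK⟩ := (isCompact_Icc (a := (0 : ℝ)) (b := 1)).bddAbove_image hg.continuousOn
    refine ⟨K, ?_⟩
    rintro _ ⟨z, hz, rfl⟩
    refine le_trans ?_ (hK ⟨z.re, hz, rfl⟩)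
    refine (norm_entriesVec_mul_le _ _).trans ?_
    refine mul_le_mul_of_nonneg_right ?_ (norm_nonneg _)
    have hl := norm_expSmul_le hH (-((1 - z) * (s / 4)))
    have hr := norm_expSmul_le hH (-(z * (s / 4)))
    have hre1 : (((-((1 - z) * (s / 4))).re : ℝ) : ℂ) = -((1 - (z.re : ℂ)) * (s / 4)) := by
      apply Complex.ext <;> simp
    have hre2 : (((-(z * (s / 4))).re : ℝ) : ℂ) = -((z.re : ℂ) * (s / 4)) := by
      apply Complex.ext <;> simp
    rw [hre1] at hl
    rw [hre2] at hr
    refine (norm_mul_le _ _).trans (mul_le_mul_of_nonneg_right ?_ (norm_nonneg _))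
    refine (norm_mul_le _ _).trans (mul_le_mul ?_ hr (norm_nonneg _) (by positivity))
    exact (norm_mul_le _ _).trans (mul_le_mul_of_nonneg_right hl (norm_nonneg _))
  have hleft : ∀ z ∈ re ⁻¹' {(0 : ℝ)}, ‖f z‖ ≤ ‖B‖ * ‖entriesVec (expSmul H (-(s / 2)))‖ := by
    intro z hz
    have hz0 : z.re = 0 := hz
    have hsplit : expSmul H (-((1 - z) * (s / 4))) =
        expSmul H (-(s / 4)) * expSmul H (z * (s / 4)) := by
      rw [expSmul_mul_expSmul]
      congr 1
      ring
    have hl : ‖expSmul H (z * (s / 4))‖ ≤ 1 := norm_expSmul_le_one hH (by simp [hz0])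
    have hr : ‖expSmul H (-(z * (s / 4)))‖ ≤ 1 := norm_expSmul_le_one hH (by simp [hz0])
    have hX : ‖expSmul H (z * (s / 4)) * B * expSmul H (-(z * (s / 4))) * O‖ ≤ ‖B‖ := by
      calc _ ≤ ‖expSmul H (z * (s / 4))‖ * ‖B‖ * ‖expSmul H (-(z * (s / 4)))‖ * ‖O‖ := by
            refine (norm_mul_le _ _).trans (mul_le_mul_of_nonneg_right ?_ (norm_nonneg _))
            exact norm_mul₃_le
        _ ≤ 1 * ‖B‖ * 1 * 1 := by gcongr
        _ = ‖B‖ := by ring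
    have h := norm_entriesVec_conj_le hH s
      (expSmul H (z * (s / 4)) * B * expSmul H (-(z * (s / 4))) * O)
    simp only [f, hsplit]
    simp only [← mul_assoc] at h ⊢
    exact h.trans (mul_le_mul_of_nonneg_right hX (norm_nonneg _))
  have hright : ∀ z ∈ re ⁻¹' {(1 : ℝ)}, ‖f z‖ ≤
      ‖B‖ * ‖entriesVec (expSmul H (-(s / 4)) * O * expSmul H (-(s / 4)))‖ := by
    intro z hz
    have hz1 : z.re = 1 := hz
    have hsplit : expSmul H (-(z * (s / 4))) =
        expSmul H ((1 - z) * (s / 4)) * expSmul H (-(s / 4)) := by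
      rw [expSmul_mul_expSmul]
      congr 1
      ring
    have hl : ‖expSmul H (-((1 - z) * (s / 4)))‖ ≤ 1 := norm_expSmul_le_one hH (by simp [hz1])
    have hr : ‖expSmul H ((1 - z) * (s / 4))‖ ≤ 1 := norm_expSmul_le_one hH (by simp [hz1])
    have hX : ‖expSmul H (-((1 - z) * (s / 4))) * B * expSmul H ((1 - z) * (s / 4))‖ ≤ ‖B‖ := by
      calc _ ≤ ‖expSmul H (-((1 - z) * (s / 4)))‖ * ‖B‖ * ‖expSmul H ((1 - z) * (s / 4))‖ :=
            norm_mul₃_le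
        _ ≤ 1 * ‖B‖ * 1 := by gcongr
        _ = ‖B‖ := by ring
    have h := norm_entriesVec_mul_le
      (expSmul H (-((1 - z) * (s / 4))) * B * expSmul H ((1 - z) * (s / 4)))
      (expSmul H (-(s / 4)) * O * expSmul H (-(s / 4)))
    simp only [f, hsplit]
    simp only [← mul_assoc] at h ⊢
    exact h.trans (mul_le_mul_of_nonneg_right hX (norm_nonneg _))
  exact HadamardThreeLines.norm_le_interp_of_mem_verticalClosedStrip₀₁' f (z := (θ : ℂ))
    ⟨h0, h1⟩ hf.diffContOnCl hbdd hleft hright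

lemma kmsNormGibbs_mul_le [NeZero n] (hH : H.IsHermitian) {β β₀ : ℝ} (hβ₀ : 0 < β₀)
    (hβ : 4 * β₀ < β) (A O : Matrix (Fin n) (Fin n) ℂ) (hO : ‖O‖ ≤ 1) :
    kmsNormGibbs H β (A * O) ≤
      kmsNormGibbs H β O ^ (4 * β₀ / β) * ‖expSmul H (-β₀) * A * expSmul H β₀‖ := by
  have hβpos : 0 < β := by linarith
  have hθ0 : 0 ≤ 4 * β₀ / β := by positivity
  have hθ1 : 4 * β₀ / β ≤ 1 := by rw [div_le_one hβpos]; exact hβ.le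
  have hZ := norm_entriesVec_expSmul_pos (H := H) (-(β / 2))
  have h := norm_entriesVec_interp_le hH β hθ0 hθ1 (expSmul H (-β₀) * A * expSmul H β₀) O hO
  have hβc : (β : ℂ) ≠ 0 := by exact_mod_cast hβpos.ne'
  have hr : -(((4 * β₀ / β : ℝ) : ℂ) * (β / 4)) = -(β₀ : ℂ) := by
    push_cast
    field_simp
  have hl : expSmul H (-((1 - ((4 * β₀ / β : ℝ) : ℂ)) * (β / 4))) =
      expSmul H (-(β / 4)) * expSmul H β₀ := by
    rw [expSmul_mul_expSmul]
    congr 1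
    linear_combination -hr
  rw [hl, hr] at h
  have hprod : expSmul H (-(β / 4)) * expSmul H β₀ * (expSmul H (-β₀) * A * expSmul H β₀) *
      expSmul H (-β₀) * O * expSmul H (-(β / 4)) =
      expSmul H (-(β / 4)) * (A * O) * expSmul H (-(β / 4)) := by
    simp only [mul_assoc, expSmul_mul_cancel_left]
  rw [hprod] at h
  set b := ‖expSmul H (-β₀) * A * expSmul H β₀‖
  have hb : 0 ≤ b := norm_nonneg _
  rw [kmsNormGibbs_eq hH, kmsNormGibbs_eq hH, div_le_iff₀ hZ]
  refine h.trans_eq ?_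
  set Z := ‖entriesVec (expSmul H (-(β / 2)))‖
  rw [Real.mul_rpow hb hZ.le, Real.mul_rpow hb (norm_nonneg _),
    Real.div_rpow (norm_nonneg _) hZ.le, Real.rpow_sub hZ, Real.rpow_one]
  have hbb : b ^ (1 - 4 * β₀ / β) * b ^ (4 * β₀ / β) = b := by
    rw [← Real.rpow_add_of_nonneg hb (by linarith) hθ0, sub_add_cancel, Real.rpow_one]
  have hZθ : Z ^ (4 * β₀ / β) ≠ 0 := (Real.rpow_pos_of_pos hZ _).ne'
  generalize 4 * β₀ / β = θ at hbb hZθ ⊢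
  field_simp
  rw [hbb, mul_comm]

end expSmul

lemma one_le_exp_sq_div {x : ℝ} (hx : 0 < x) : 1 ≤ Real.exp (x ^ 2) / x := by
  rw [one_le_div hx]
  nlinarith [Real.add_one_le_exp (x ^ 2), sq_nonneg (x - 1)]

end

/-- Hölder-like inequality in the KMS weighted norm with regularized Gibbs conjugation:
there is an absolute constant `C > 0` such that for any Hermitian `H`, `σ > 0`,
`β > 4β₀ > 0` (with `β' := β/4 − β₀`), and `‖A‖,‖O‖ ≤ 1`, both `‖AO‖_{ρ_β}` and `‖OA‖_{ρ_β}`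
are bounded by
`C (e^{σ²β'²}/(β'σ) + e^{σ²β₀²}/(β₀σ)) ‖O‖_{ρ_β}^{4β₀/β} (‖ρ_{β₀}Aρ_{β₀}^{−1}‖ + ‖ρ_{β₀}^{−1}Aρ_{β₀}‖)`. -/
theorem kmsNorm_mul_le_regularized :
    ∃ C : ℝ, 0 < C ∧
      ∀ (n : ℕ) (H : Matrix (Fin n) (Fin n) ℂ), H.IsHermitian →
        ∀ (σ β β₀ : ℝ), 0 < σ → 0 < β₀ → 4 * β₀ < β →
          ∀ A O : Matrix (Fin n) (Fin n) ℂ, ‖A‖ ≤ 1 → ‖O‖ ≤ 1 →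
            kmsNormGibbs H β (A * O) ≤
              C * (Real.exp (σ ^ 2 * (β / 4 - β₀) ^ 2) / ((β / 4 - β₀) * σ) +
                    Real.exp (σ ^ 2 * β₀ ^ 2) / (β₀ * σ)) *
                kmsNormGibbs H β O ^ (4 * β₀ / β) *
                (‖gibbs H β₀ * A * (gibbs H β₀)⁻¹‖ + ‖(gibbs H β₀)⁻¹ * A * gibbs H β₀‖) ∧
            kmsNormGibbs H β (O * A) ≤
              C * (Real.exp (σ ^ 2 * (β / 4 - β₀) ^ 2) / ((β / 4 - β₀) * σ) +
                    Real.exp (σ ^ 2 * β₀ ^ 2) / (β₀ * σ)) *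
                kmsNormGibbs H β O ^ (4 * β₀ / β) *
                (‖gibbs H β₀ * A * (gibbs H β₀)⁻¹‖ + ‖(gibbs H β₀)⁻¹ * A * gibbs H β₀‖) := by
  refine ⟨1, one_pos, fun n H hH σ β β₀ hσ hβ₀ hβ A O _ hO => ?_⟩
  have hβ' : 0 < β / 4 - β₀ := by linarith
  have hconst : 1 ≤ 1 * (Real.exp (σ ^ 2 * (β / 4 - β₀) ^ 2) / ((β / 4 - β₀) * σ) +
      Real.exp (σ ^ 2 * β₀ ^ 2) / (β₀ * σ)) := by
    have h : 1 ≤ Real.exp (σ ^ 2 * β₀ ^ 2) / (β₀ * σ) := by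
      rw [mul_comm (σ ^ 2), ← mul_pow]
      exact one_le_exp_sq_div (mul_pos hβ₀ hσ)
    rw [one_mul]
    exact h.trans (le_add_of_nonneg_left (by positivity))
  have hnonneg (X : Matrix (Fin n) (Fin n) ℂ) : 0 ≤ kmsNormGibbs H β X := Real.sqrt_nonneg _
  have hθ := Real.rpow_nonneg (hnonneg O) (4 * β₀ / β)
  rcases Nat.eq_zero_or_pos n with rfl | hn
  · have hzero (X : Matrix (Fin 0) (Fin 0) ℂ) : kmsNormGibbs H β X = 0 := by
      simp [kmsNormGibbs, Matrix.trace]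
    rw [hzero (A * O), hzero (O * A)]
    constructor <;> positivity
  have : NeZero n := ⟨hn.ne'⟩
  have hstep {x a b : ℝ} (hb : 0 ≤ b) (ha : 0 ≤ a)
      (h : x ≤ kmsNormGibbs H β O ^ (4 * β₀ / β) * a) :
      x ≤ 1 * (Real.exp (σ ^ 2 * (β / 4 - β₀) ^ 2) / ((β / 4 - β₀) * σ) +
        Real.exp (σ ^ 2 * β₀ ^ 2) / (β₀ * σ)) * kmsNormGibbs H β O ^ (4 * β₀ / β) * (a + b) := by
    rw [mul_assoc]
    refine h.trans ((mul_le_mul_of_nonneg_left (le_add_of_nonneg_right hb) hθ).trans ?_)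
    exact le_mul_of_one_le_left (by positivity) hconst
  rw [(gibbs_conj_eq hH β₀ A).1, (gibbs_conj_eq hH β₀ A).2]
  refine ⟨hstep (norm_nonneg _) (norm_nonneg _) (kmsNormGibbs_mul_le hH hβ₀ hβ A O hO), ?_⟩
  rw [add_comm ‖expSmul H (-β₀) * A * expSmul H β₀‖]
  refine hstep (norm_nonneg _) (norm_nonneg _) ?_
  have h := kmsNormGibbs_mul_le hH hβ₀ hβ Aᴴ Oᴴ (by rwa [Matrix.l2_opNorm_conjTranspose])
  have hA : expSmul H (-β₀) * Aᴴ * expSmul H β₀ = (expSmul H β₀ * A * expSmul H (-β₀))ᴴ := by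
    simp [Matrix.conjTranspose_mul, conjTranspose_expSmul hH, mul_assoc]
  rwa [← Matrix.conjTranspose_mul, kmsNormGibbs_conjTranspose hH, kmsNormGibbs_conjTranspose hH,
    hA, Matrix.l2_opNorm_conjTranspose] at h
end

section
/- Let H and A be n×n complex matrices with H Hermitian, and let ε > 0. Then ‖∫_{−ε}^{ε} (A − e^{iHt} A e^{−iHt}) dt‖ ≤ (ε³/3) · ‖[H,[H,A]]‖, where e^{iHt} is the matrix exponential, [X,Y] := XY − YX, the integral is taken entrywise, and ‖·‖ is the operator (spectral) norm. (The first-order term of the Heisenberg evolution cancels by the symmetry of the integration interval, leaving only the second-order nested commutator.) -/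
open MeasureTheory
open scoped Matrix.Norms.L2Operator Matrix

/-- A curve whose second derivative is bounded by `C` has symmetric second differences at `0`
bounded by `C * t ^ 2`. -/
theorem norm_symm_second_difference_le {E : Type*} [NormedAddCommGroup E] [NormedSpace ℝ E]
    {f f' f'' : ℝ → E} {C : ℝ} (hf : ∀ t, HasDerivAt f (f' t) t)
    (hf' : ∀ t, HasDerivAt f' (f'' t) t) (hC : ∀ t, ‖f'' t‖ ≤ C) {t : ℝ} (ht : 0 ≤ t) :
    ‖(f 0 - f t) + (f 0 - f (-t))‖ ≤ C * t ^ 2 := by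
  have hneg : ∀ {g g' : ℝ → E}, (∀ s, HasDerivAt g (g' s) s) →
      ∀ s, HasDerivAt (fun s => g (-s)) (-g' (-s)) s := fun hg s => by
    simpa [Function.comp_def] using (hg (-s)).scomp s (hasDerivAt_neg s)
  have hd : ∀ s, HasDerivAt (fun s => (f 0 - f s) + (f 0 - f (-s))) (f' (-s) - f' s) s :=
    fun s => (((hf s).const_sub (f 0)).add ((hneg hf s).const_sub (f 0))).congr_deriv (by abel)
  have hd' : ∀ s, HasDerivAt (fun s => f' (-s) - f' s) (-f'' (-s) - f'' s) s :=
    fun s => (hneg hf' s).sub (hf' s)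
  have bound : ∀ s, 0 ≤ s → ‖f' (-s) - f' s‖ ≤ 2 * C * s := fun s hs =>
    image_norm_le_of_norm_deriv_right_le_deriv_boundary (a := 0) (b := s)
      (fun x _ => (hd' x).continuousAt.continuousWithinAt)
      (fun x _ => (hd' x).hasDerivWithinAt) (by simp)
      (fun x => by simpa using (hasDerivAt_id x).const_mul (2 * C))
      (fun x _ => (norm_sub_le _ _).trans (by rw [norm_neg]; linarith [hC x, hC (-x)]))
      ⟨hs, le_rfl⟩
  exact image_norm_le_of_norm_deriv_right_le_deriv_boundary (a := 0) (b := t)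
    (B := fun x => C * x ^ 2) (B' := fun x => 2 * C * x)
    (fun x _ => (hd x).continuousAt.continuousWithinAt)
    (fun x _ => (hd x).hasDerivWithinAt) (by simp)
    (fun x => (((hasDerivAt_pow 2 x).const_mul C)).congr_deriv (by simp; ring))
    (fun x hx => bound x hx.1) ⟨ht, le_rfl⟩

/-- The deviation of a curve from its midpoint value, averaged over a symmetric interval, is
controlled by the second derivative alone. -/
theorem norm_integral_sub_le_of_norm_second_deriv_le {E : Type*} [NormedAddCommGroup E]
    [NormedSpace ℝ E] {f f' f'' : ℝ → E} {C : ℝ} (hf : ∀ t, HasDerivAt f (f' t) t)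
    (hf' : ∀ t, HasDerivAt f' (f'' t) t) (hC : ∀ t, ‖f'' t‖ ≤ C) {ε : ℝ} (hε : 0 ≤ ε) :
    ‖∫ t in (-ε)..ε, (f 0 - f t)‖ ≤ ε ^ 3 / 3 * C := by
  have hc : Continuous fun t => f 0 - f t :=
    continuous_const.sub (continuous_iff_continuousAt.2 fun t => (hf t).continuousAt)
  have hcn : Continuous fun t => f 0 - f (-t) := hc.comp continuous_neg
  have hsplit : ∫ t in (-ε)..ε, (f 0 - f t) =
      ∫ t in (0 : ℝ)..ε, ((f 0 - f t) + (f 0 - f (-t))) := by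
    rw [intervalIntegral.integral_add (hc.intervalIntegrable _ _) (hcn.intervalIntegrable _ _),
      intervalIntegral.integral_comp_neg (fun t => f 0 - f t), neg_zero, add_comm,
      intervalIntegral.integral_add_adjacent_intervals (hc.intervalIntegrable _ _)
        (hc.intervalIntegrable _ _)]
  rw [hsplit]
  calc ‖∫ t in (0 : ℝ)..ε, ((f 0 - f t) + (f 0 - f (-t)))‖
      ≤ ∫ t in (0 : ℝ)..ε, C * t ^ 2 :=
        intervalIntegral.norm_integral_le_of_norm_le hε
          (Filter.Eventually.of_forall fun t ht =>
            norm_symm_second_difference_le hf hf' hC ht.1.le)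
          (Continuous.intervalIntegrable (by fun_prop) _ _)
    _ = ε ^ 3 / 3 * C := by
        rw [intervalIntegral.integral_const_mul, integral_pow]
        norm_num
        ring

/-- The Heisenberg evolution `e^{iht} a e^{-iht}` of `a` generated by `h`. -/
noncomputable def heisenbergEvolution {𝔸 : Type*} [CStarAlgebra 𝔸] (h a : 𝔸) (t : ℝ) : 𝔸 :=
  NormedSpace.exp ((Complex.I * (t : ℂ)) • h) * a * NormedSpace.exp ((-(Complex.I * (t : ℂ))) • h)

theorem heisenbergEvolution_zero {𝔸 : Type*} [CStarAlgebra 𝔸] (h a : 𝔸) :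
    heisenbergEvolution h a 0 = a := by
  simp [heisenbergEvolution]

theorem norm_heisenbergEvolution {𝔸 : Type*} [CStarAlgebra 𝔸] {h : 𝔸} (hh : IsSelfAdjoint h)
    (a : 𝔸) (t : ℝ) : ‖heisenbergEvolution h a t‖ = ‖a‖ := by
  let +nondep : NormedAlgebra ℚ 𝔸 := .restrictScalars ℚ ℂ 𝔸
  have hu : ∀ s : ℝ, NormedSpace.exp ((Complex.I * (s : ℂ)) • h) ∈ unitary 𝔸 := fun s =>
    NormedSpace.exp_mem_unitary_of_mem_skewAdjoint
      (hh.smul_mem_skewAdjoint (by simp [skewAdjoint.mem_iff]))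
  have hneg := hu (-t)
  rw [Complex.ofReal_neg, mul_neg] at hneg
  rw [heisenbergEvolution, CStarRing.norm_mul_mem_unitary _ hneg,
    CStarRing.norm_mem_unitary_mul _ (hu t)]

/-- Heisenberg's equation of motion. -/
theorem hasDerivAt_heisenbergEvolution {𝔸 : Type*} [CStarAlgebra 𝔸] (h a : 𝔸) (t : ℝ) :
    HasDerivAt (heisenbergEvolution h a)
      (heisenbergEvolution h (Complex.I • (h * a - a * h)) t) t := by
  have hexp : ∀ (c : ℂ) (k : 𝔸), c • h = k → HasDerivAt
      (fun s : ℝ => NormedSpace.exp ((c * (s : ℂ)) • h))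
      (NormedSpace.exp ((c * (t : ℂ)) • h) * k) t := by
    rintro c k rfl
    have key := hasDerivAt_exp_smul_const (𝕂 := ℝ) (c • h) t
    have hs : ∀ s : ℝ, s • c • h = (c * (s : ℂ)) • h := fun s => by
      rw [← Complex.coe_smul, smul_smul, mul_comm]
    simpa only [hs] using key
  have hexp' : HasDerivAt (fun s : ℝ => NormedSpace.exp ((-(Complex.I * (s : ℂ))) • h))
      (-(Complex.I • h) * NormedSpace.exp ((-(Complex.I * (t : ℂ))) • h)) t := by
    have key := hexp (-Complex.I) _ (neg_smul _ _)
    have hcomm : Commute (NormedSpace.exp ((-Complex.I * (t : ℂ)) • h)) (-(Complex.I • h)) :=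
      (((Commute.refl h).smul_left _).exp_left).smul_right _ |>.neg_right
    rw [hcomm.eq] at key
    simpa only [neg_mul] using key
  refine (((hexp Complex.I _ rfl).mul_const a).mul hexp').congr_deriv ?_
  simp only [heisenbergEvolution, smul_sub, mul_sub, sub_mul, mul_neg, neg_mul, mul_smul_comm,
    smul_mul_assoc, mul_assoc, ← sub_eq_add_neg]

theorem norm_integral_sub_heisenbergEvolution_le {𝔸 : Type*} [CStarAlgebra 𝔸] {h : 𝔸}
    (hh : IsSelfAdjoint h) (a : 𝔸) {ε : ℝ} (hε : 0 ≤ ε) :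
    ‖∫ t in (-ε)..ε, (a - heisenbergEvolution h a t)‖ ≤
      ε ^ 3 / 3 * ‖h * (h * a - a * h) - (h * a - a * h) * h‖ := by
  have key := norm_integral_sub_le_of_norm_second_deriv_le
    (hasDerivAt_heisenbergEvolution h a) (hasDerivAt_heisenbergEvolution h _)
    (fun t => (norm_heisenbergEvolution hh _ t).le) hε
  rwa [heisenbergEvolution_zero, norm_smul, Complex.norm_I, one_mul, mul_smul_comm,
    smul_mul_assoc, ← smul_sub, norm_smul, Complex.norm_I, one_mul] at key

/-- Second-order Taylor bound for symmetrically time-averaged Heisenberg evolution: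
`‖∫_{−ε}^{ε} (A − e^{iHt} A e^{−iHt}) dt‖ ≤ (ε³/3)·‖[H,[H,A]]‖`, the integral taken
entrywise and `‖·‖` the spectral norm. -/
theorem norm_integral_heisenberg_sub_le {n : ℕ} {H A : Matrix (Fin n) (Fin n) ℂ}
    (hH : H.IsHermitian) (ε : ℝ) (hε : 0 < ε) :
    ‖Matrix.of (fun i j : Fin n => ∫ t in (-ε)..ε,
        (A i j - (NormedSpace.exp ((Complex.I * (t : ℂ)) • H) * A *
          NormedSpace.exp ((-(Complex.I * (t : ℂ))) • H)) i j))‖ ≤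
      ε ^ 3 / 3 * ‖H * (H * A - A * H) - (H * A - A * H) * H‖ := by
  have hc : Continuous fun t => A - heisenbergEvolution H A t :=
    continuous_const.sub (continuous_iff_continuousAt.2 fun t =>
      (hasDerivAt_heisenbergEvolution H A t).continuousAt)
  convert norm_integral_sub_heisenbergEvolution_le (show IsSelfAdjoint H from hH) A hε.le using 2
  ext i j
  exact (LinearMap.toContinuousLinearMap
    (Matrix.entryLinearMap ℂ ℂ i j)).intervalIntegral_comp_comm (hc.intervalIntegrable (-ε) ε)
end
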